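/- If T is a first-order theory in a language L such that the diagonal function mapping a formula φ(x) to the sentence φ(⌜φ⌝) is representable in T, then there is no L-formula V(x) such that T proves ψ ↔ V(⌜ψ⌝) for every L-sentence ψ. -/

import Mathlib

/- Tarski's Undefinability of Truth (general form):
If the diagonal function φ(x) ↦ φ(⌜φ⌝) is representable in a consistent theory T,
then there is no formula V(x) such that T ⊢ ψ ↔ V(⌜ψ⌝) for every sentence ψ. -/

open FirstOrder Language

namespace TarskiUndef

variable {L : Language}

/-- Substitute a closed term for the unique free variable of a one-variable formula,
yielding a sentence: `φ(t)`. -/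
noncomputable def app (φ : L.Formula (Fin 1)) (t : L.Term Empty) : L.Sentence :=
  φ.subst (fun _ => t)

/-- The sentence `∀ y (F(⌜φ⌝, y) ↔ y = ⌜f φ⌝)` expressing that `F` represents, at input
`⌜φ⌝`, the output `⌜f φ⌝`. -/
noncomputable def repSentence (F : L.Formula (Fin 2)) (num : ℕ → L.Term Empty)
    (input output : ℕ) : L.Sentence :=
  ((((F.subst ![(num input).relabel (fun x => x.elim), Term.var 0]) ⇔
      (Term.equal (Term.var 0) ((num output).relabel (fun x => x.elim)))).relabel
        (fun _ => Sum.inr (0 : Fin 1)) : L.BoundedFormula Empty 1)).all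

theorem realize_app {M : Type*} [L.Structure M] (φ : L.Formula (Fin 1)) (t : L.Term Empty) :
    M ⊨ app φ t ↔ φ.Realize (fun _ => t.realize (default : Empty → M)) := by
  simp only [app, Sentence.Realize, Formula.Realize, BoundedFormula.realize_subst]

theorem realize_diag {M : Type*} [L.Structure M] (F : L.Formula (Fin 2)) (V : L.Formula (Fin 1))
    (t : L.Term Empty) :
    M ⊨ app (((BoundedFormula.relabel (n := 1) (k := 0) (![Sum.inl 0, Sum.inr 0] : Fin 2 → Fin 1 ⊕ Fin 1) F :
        L.BoundedFormula (Fin 1) 1)).imp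
      (BoundedFormula.relabel (n := 1) (k := 0) (fun _ => Sum.inr 0 : Fin 1 → Fin 1 ⊕ Fin 1) V :
        L.BoundedFormula (Fin 1) 1).not).all t ↔
    ∀ y : M, F.Realize ![t.realize default, y] → ¬ V.Realize (fun _ => y) := by
  rw [realize_app, Formula.Realize, BoundedFormula.realize_all]
  refine forall_congr' fun y => ?_
  rw [BoundedFormula.realize_imp, BoundedFormula.realize_not]
  have e1 := BoundedFormula.realize_relabel (M := M) (φ := F) (m := 1) (n := 0)
    (g := (![Sum.inl 0, Sum.inr 0] : Fin 2 → Fin 1 ⊕ Fin 1))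
    (v := fun _ => t.realize default) (xs := Fin.snoc default y)
  have e2 := BoundedFormula.realize_relabel (M := M) (φ := V) (m := 1) (n := 0)
    (g := (fun _ => Sum.inr 0 : Fin 1 → Fin 1 ⊕ Fin 1))
    (v := fun _ => t.realize default) (xs := Fin.snoc default y)
  refine (imp_congr e1 (not_congr e2)).trans ?_
  refine imp_congr (iff_of_eq ?_) (not_congr (iff_of_eq ?_))
  · unfold Formula.Realize
    congr 1
    · funext i
      fin_cases i <;> simp [Fin.snoc]
    · exact Subsingleton.elim _ _
  · unfold Formula.Realize
    congr 1
    · exact Subsingleton.elim _ _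

theorem realize_rep {M : Type*} [L.Structure M] (F : L.Formula (Fin 2)) (num : ℕ → L.Term Empty)
    (a b : ℕ) : M ⊨ repSentence F num a b ↔
    ∀ y : M, F.Realize ![(num a).realize default, y] ↔ y = (num b).realize default := by
  unfold repSentence
  rw [Sentence.Realize, Formula.Realize, BoundedFormula.realize_all]
  refine forall_congr' fun y => ?_
  refine (BoundedFormula.realize_relabel (m := 1) (n := 0)).trans ?_
  rw [BoundedFormula.realize_iff, BoundedFormula.realize_subst]
  refine iff_congr (iff_of_eq ?_) ?_
  · unfold Formula.Realize
    congr 1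
    · funext i
      fin_cases i
      · simp [Term.realize_relabel]
        congr 1
        exact Subsingleton.elim _ _
      · simp [Fin.snoc]
    · exact Subsingleton.elim _ _
  · refine (Formula.boundedFormula_realize_eq_realize _ _ _).trans ?_
    rw [Formula.realize_equal, Term.realize_relabel]
    refine iff_of_eq (congrArg₂ _ ?_ ?_)
    · simp [Fin.snoc]
    · congr 1
      exact Subsingleton.elim _ _

theorem tarski_undefinability_of_truth
    (T : L.Theory) (hconsis : T.IsSatisfiable)
    -- a Gödel numbering of one-variable formulas and of sentences, and numerals
    (code₁ : L.Formula (Fin 1) → ℕ) (codeS : L.Sentence → ℕ) (num : ℕ → L.Term Empty)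
    -- the diagonal function φ(x) ↦ φ(⌜φ⌝)
    (diag : L.Formula (Fin 1) → L.Sentence)
    (hdiag : ∀ φ : L.Formula (Fin 1), diag φ = app φ (num (code₁ φ)))
    -- the diagonal function is representable in T
    (hrep : ∃ F : L.Formula (Fin 2),
      ∀ φ : L.Formula (Fin 1), T ⊨ᵇ repSentence F num (code₁ φ) (codeS (diag φ))) :
    ¬ ∃ V : L.Formula (Fin 1),
        ∀ ψ : L.Sentence, T ⊨ᵇ (ψ ⇔ app V (num (codeS ψ))) := by
  rintro ⟨V, hV⟩
  obtain ⟨F, hF⟩ := hrep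
  obtain ⟨M⟩ := hconsis
  let B : L.Formula (Fin 1) :=
    (((BoundedFormula.relabel (n := 1) (k := 0) (![Sum.inl 0, Sum.inr 0] : Fin 2 → Fin 1 ⊕ Fin 1) F : L.BoundedFormula (Fin 1) 1)).imp
      (BoundedFormula.relabel (n := 1) (k := 0) (fun _ => Sum.inr 0 : Fin 1 → Fin 1 ⊕ Fin 1) V : L.BoundedFormula (Fin 1) 1).not).all
  have h1 := (hF B).realize_sentence M
  have h2 := (hV (diag B)).realize_sentence M
  have h3 : M ⊨ diag B ↔ ∀ y : M, F.Realize ![(num (code₁ B)).realize default, y] →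
      ¬ V.Realize (fun _ => y) := by
    rw [hdiag]
    exact realize_diag F V _
  have h4 := (realize_rep F num _ _).1 h1
  have h5 : M ⊨ diag B ↔ M ⊨ app V (num (codeS (diag B))) := by
    simpa [Sentence.Realize, Formula.Realize] using h2
  rw [realize_app] at h5
  simp only [h4, forall_eq] at h3
  tauto

end TarskiUndef
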